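/- Hankel determinants two indices apart have no common positive real zero: there is no n ≥ 0 and no ω* > 0 such that h_n(ω*) = 0 and h_{n+2}(ω*) = 0. -/

import Mathlib

open MeasureTheory

/-- Moments of the oscillatory weight `e^{iωx}` on `[-1,1]`. -/
noncomputable def mu (ω : ℝ) (n : ℕ) : ℂ :=
  ∫ x : ℝ in (-1 : ℝ)..1, (x : ℂ) ^ n * Complex.exp (Complex.I * ω * x)

/-- The `(n+1) × (n+1)` Hankel determinant of the moments. -/
noncomputable def hankel (n : ℕ) (ω : ℝ) : ℂ :=
  Matrix.det (Matrix.of fun j k : Fin (n + 1) => mu ω ((j : ℕ) + (k : ℕ)))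

namespace KissingPolynomial

open Polynomial

section Legendre

lemma C_two : C (2 : ℂ) = 2 := map_ofNat C 2

lemma C_three : C (3 : ℂ) = 3 := map_ofNat C 3

/-- The Legendre polynomials over `ℂ`, defined by their three-term recurrence. -/
noncomputable def legendre : ℕ → ℂ[X]
  | 0 => 1
  | 1 => X
  | k + 2 => C ((2 * k + 3) / (k + 2) : ℂ) * (X * legendre (k + 1))
      - C ((k + 1) / (k + 2) : ℂ) * legendre k

lemma legendre_recurrence (k : ℕ) :
    ((k : ℂ[X]) + 2) * legendre (k + 2) =
      (2 * (k : ℂ[X]) + 3) * (X * legendre (k + 1)) - ((k : ℂ[X]) + 1) * legendre k := by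
  have hk : (k : ℂ) + 2 ≠ 0 := by exact_mod_cast (by omega : k + 2 ≠ 0)
  have e : (k : ℂ[X]) + 2 = C ((k : ℂ) + 2) := by simp [C_two]
  have e1 : C ((k : ℂ) + 2) * C ((2 * k + 3) / (k + 2) : ℂ) = 2 * (k : ℂ[X]) + 3 := by
    rw [← C_mul, mul_div_cancel₀ _ hk]; simp [C_two, C_three]
  have e2 : C ((k : ℂ) + 2) * C ((k + 1) / (k + 2) : ℂ) = (k : ℂ[X]) + 1 := by
    rw [← C_mul, mul_div_cancel₀ _ hk]; simp
  rw [legendre, e, mul_sub, ← mul_assoc, ← mul_assoc (C ((k : ℂ) + 2)), e1, e2]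

lemma legendre_derivative_relations (k : ℕ) :
    derivative (legendre (k + 1)) - X * derivative (legendre k) =
      ((k : ℂ[X]) + 1) * legendre k ∧
    X * derivative (legendre (k + 1)) - derivative (legendre k) =
      ((k : ℂ[X]) + 1) * legendre (k + 1) := by
  induction k with
  | zero => simp [legendre]
  | succ k ih =>
    obtain ⟨hA, hB⟩ := ih
    have hk : (k : ℂ[X]) + 2 ≠ 0 := by exact_mod_cast (by omega : k + 2 ≠ 0)
    have hR := legendre_recurrence k
    have hR' := congrArg derivative hR
    simp only [derivative_mul, derivative_sub, derivative_add, derivative_natCast,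
      derivative_ofNat, derivative_one, derivative_X] at hR'
    push_cast
    have hA' : derivative (legendre (k + 2)) - X * derivative (legendre (k + 1)) =
        ((k : ℂ[X]) + 1 + 1) * legendre (k + 1) := by
      apply mul_left_cancel₀ hk
      linear_combination hR' + (k + 1) * hB
    refine ⟨hA', ?_⟩
    linear_combination X * hA' + X * hB - hA - hR

lemma X_sq_sub_one_mul_derivative_legendre (k : ℕ) :
    (X ^ 2 - 1) * derivative (legendre (k + 1)) =
      ((k : ℂ[X]) + 1) * (X * legendre (k + 1) - legendre k) := by
  obtain ⟨hA, hB⟩ := legendre_derivative_relations k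
  linear_combination X * hB - hA

lemma legendre_ode (k : ℕ) :
    derivative ((X ^ 2 - 1) * derivative (legendre k)) = (k * (k + 1) : ℂ) • legendre k := by
  rw [smul_eq_C_mul]
  cases k with
  | zero => simp [legendre]
  | succ k =>
    obtain ⟨hA, hB⟩ := legendre_derivative_relations k
    rw [X_sq_sub_one_mul_derivative_legendre]
    simp only [derivative_mul, derivative_sub, derivative_add, derivative_natCast,
      derivative_one, derivative_X]
    simp
    linear_combination (k + 1) * hB

lemma degree_legendre (k : ℕ) : (legendre k).degree = k := by
  induction k using Nat.strong_induction_on with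
  | _ k ih =>
    match k with
    | 0 => simp [legendre]
    | 1 => simp [legendre]
    | k + 2 =>
      have h1 := ih (k + 1) (by omega)
      have h0 := ih k (by omega)
      have n2 : ((2 * k + 3) / (k + 2) : ℂ) ≠ 0 :=
        div_ne_zero (by exact_mod_cast (by omega : 2 * k + 3 ≠ 0))
          (by exact_mod_cast (by omega : k + 2 ≠ 0))
      have n1 : ((k + 1) / (k + 2) : ℂ) ≠ 0 :=
        div_ne_zero (by exact_mod_cast (by omega : k + 1 ≠ 0))
          (by exact_mod_cast (by omega : k + 2 ≠ 0))
      have d1 : (C ((2 * k + 3) / (k + 2) : ℂ) * (X * legendre (k + 1))).degree =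
          ((k + 2 : ℕ) : WithBot ℕ) := by
        rw [degree_C_mul n2, degree_mul, degree_X, h1]
        norm_cast
        ring
      rw [legendre, degree_sub_eq_left_of_degree_lt, d1]
      rw [d1, degree_C_mul n1, h0]
      exact_mod_cast (by omega : k < k + 2)

/-- The Legendre polynomials as a degree-graded sequence. -/
noncomputable def legendreSequence : Polynomial.Sequence ℂ := ⟨legendre, degree_legendre⟩

lemma isUnit_leadingCoeff_legendreSequence (i : ℕ) :
    IsUnit (legendreSequence i).leadingCoeff :=
  isUnit_iff_ne_zero.2 (leadingCoeff_ne_zero.2 (legendreSequence.ne_zero i))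

/-- The Legendre basis of `ℂ[X]`. -/
noncomputable def legendreBasis : Module.Basis ℕ ℂ ℂ[X] :=
  legendreSequence.basis isUnit_leadingCoeff_legendreSequence

lemma legendreBasis_apply (k : ℕ) : legendreBasis k = legendre k :=
  legendreSequence.basis_eq_self _ k

lemma legendreBasis_coord_legendre (k j : ℕ) :
    legendreBasis.coord k (legendre j) = if j = k then 1 else 0 := by
  rw [← legendreBasis_apply, Module.Basis.coord_apply, Module.Basis.repr_self,
    Finsupp.single_apply]

lemma legendreBasis_coord_eq_zero {n k : ℕ} (hk : n ≤ k) {P : ℂ[X]} (hP : P ∈ degreeLT ℂ n) :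
    legendreBasis.coord k P = 0 := by
  rw [← legendreSequence.span_degreeLT (fun i _ => isUnit_leadingCoeff_legendreSequence i)] at hP
  have : Submodule.span ℂ (legendreSequence '' Set.Iio n) ≤
      LinearMap.ker (legendreBasis.coord k) := by
    rw [Submodule.span_le]
    rintro _ ⟨i, hi, rfl⟩
    have hik : i ≠ k := by have := Set.mem_Iio.1 hi; omega
    exact (legendreBasis_coord_legendre k i).trans (if_neg hik)
  exact this hP

/-- The operator `P ↦ (X² - 1) P' - m X P`. -/
noncomputable def shift (m : ℕ) : ℂ[X] →ₗ[ℂ] ℂ[X] :=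
  LinearMap.mulLeft ℂ (X ^ 2 - 1) ∘ₗ derivative - LinearMap.mulLeft ℂ ((m : ℂ[X]) * X)

lemma shift_apply (m : ℕ) (P : ℂ[X]) :
    shift m P = (X ^ 2 - 1) * derivative P - (m : ℂ[X]) * X * P := rfl

lemma shift_legendre_zero (m : ℕ) : shift m (legendre 0) = (-m : ℂ) • legendre 1 := by
  simp [shift_apply, legendre, smul_eq_C_mul]

lemma shift_legendre_succ (m j : ℕ) :
    shift m (legendre (j + 1)) =
      ((j + 1 - m) * (j + 2) / (2 * j + 3) : ℂ) • legendre (j + 2)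
        - ((j + 1) * (j + 2 + m) / (2 * j + 3) : ℂ) • legendre j := by
  have hj : (2 * j + 3 : ℂ) ≠ 0 := by exact_mod_cast (by omega : 2 * j + 3 ≠ 0)
  have hJ : C (2 * j + 3 : ℂ) ≠ 0 := C_ne_zero.2 hj
  have e1 : C (2 * j + 3 : ℂ) * C ((j + 1 - m) * (j + 2) / (2 * j + 3) : ℂ) =
      ((j : ℂ[X]) + 1 - m) * (j + 2) := by
    rw [← C_mul, mul_div_cancel₀ _ hj]; simp [C_two]
  have e2 : C (2 * j + 3 : ℂ) * C ((j + 1) * (j + 2 + m) / (2 * j + 3) : ℂ) =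
      ((j : ℂ[X]) + 1) * (j + 2 + m) := by
    rw [← C_mul, mul_div_cancel₀ _ hj]; simp [C_two]
  have e3 : C (2 * j + 3 : ℂ) = 2 * (j : ℂ[X]) + 3 := by simp [C_two, C_three]
  apply mul_left_cancel₀ hJ
  rw [smul_eq_C_mul, smul_eq_C_mul, mul_sub, ← mul_assoc _ _ (legendre (j + 2)),
    ← mul_assoc _ _ (legendre j), e1, e2, e3, shift_apply,
    X_sq_sub_one_mul_derivative_legendre]
  linear_combination -(j + 1 - m : ℂ[X]) * legendre_recurrence j

lemma coord_legendre_operator (k : ℕ) (P : ℂ[X]) :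
    legendreBasis.coord k (derivative ((X ^ 2 - 1) * derivative P)) =
      (k * (k + 1) : ℂ) * legendreBasis.coord k P := by
  have : legendreBasis.coord k ∘ₗ derivative ∘ₗ LinearMap.mulLeft ℂ (X ^ 2 - 1) ∘ₗ derivative =
      (k * (k + 1) : ℂ) • legendreBasis.coord k := by
    refine legendreBasis.ext fun j => ?_
    simp only [LinearMap.comp_apply, LinearMap.mulLeft_apply, LinearMap.smul_apply,
      legendreBasis_apply, legendre_ode, map_smul, legendreBasis_coord_legendre]
    split_ifs with h
    · rw [h]
    · simp
  exact LinearMap.congr_fun this P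

lemma coord_zero_shift (m : ℕ) (P : ℂ[X]) :
    legendreBasis.coord 0 (shift m P) = -((2 + m) / 3 : ℂ) * legendreBasis.coord 1 P := by
  have : legendreBasis.coord 0 ∘ₗ shift m = (-((2 + m) / 3 : ℂ)) • legendreBasis.coord 1 := by
    refine legendreBasis.ext fun j => ?_
    rw [LinearMap.comp_apply, LinearMap.smul_apply, legendreBasis_apply]
    cases j with
    | zero =>
      rw [shift_legendre_zero, map_smul, legendreBasis_coord_legendre,
        legendreBasis_coord_legendre]
      simp
    | succ j =>
      rw [shift_legendre_succ, map_sub, map_smul, map_smul]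
      simp only [legendreBasis_coord_legendre]
      rcases Nat.eq_zero_or_pos j with rfl | hj
      · simp
      · simp [hj.ne']
  exact LinearMap.congr_fun this P

lemma coord_succ_shift (m k : ℕ) (P : ℂ[X]) :
    legendreBasis.coord (k + 1) (shift m P) =
      ((k + 1) * (k - m) / (2 * k + 1) : ℂ) * legendreBasis.coord k P
        - ((k + 2) * (k + 3 + m) / (2 * k + 5) : ℂ) * legendreBasis.coord (k + 2) P := by
  have : legendreBasis.coord (k + 1) ∘ₗ shift m =
      ((k + 1) * (k - m) / (2 * k + 1) : ℂ) • legendreBasis.coord k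
        - ((k + 2) * (k + 3 + m) / (2 * k + 5) : ℂ) • legendreBasis.coord (k + 2) := by
    refine legendreBasis.ext fun j => ?_
    rw [LinearMap.comp_apply, LinearMap.sub_apply, LinearMap.smul_apply, LinearMap.smul_apply,
      legendreBasis_apply]
    cases j with
    | zero =>
      rw [shift_legendre_zero, map_smul]
      simp only [legendreBasis_coord_legendre]
      rcases Nat.eq_zero_or_pos k with rfl | hk
      · simp
      · simp [hk.ne, hk.ne']
    | succ j =>
      rw [shift_legendre_succ, map_sub, map_smul, map_smul]
      simp only [legendreBasis_coord_legendre]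
      by_cases h1 : j + 1 = k
      · subst h1
        have h2 : ¬ j = j + 1 + 1 := by omega
        simp [h2]
        ring
      · by_cases h2 : j = k + 1
        · subst h2
          simp [h1]
          ring
        · simp [h1, h2]
  exact LinearMap.congr_fun this P

end Legendre

/-- Solutions of a tridiagonal system with negative diagonal and skew-symmetrizable off-diagonal
part: the imaginary parts of `c k * conj (c (k + 1))` have constant sign. -/
lemma tridiagonal_energy {m : ℕ} {ω : ℝ} (hω : 0 < ω) {c : ℕ → ℂ} {d a b : ℕ → ℝ}
    (h0 : (d 0 : ℂ) * c 0 = Complex.I * ω * (b 0 * c 1))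
    (hs : ∀ k, (d (k + 1) : ℂ) * c (k + 1) = Complex.I * ω * (a k * c k + b (k + 1) * c (k + 2)))
    (hd : ∀ k < m, d k < 0) (ha : ∀ k < m, 0 < a k) (hb : ∀ k, 0 < b k) {k : ℕ} (hk : k < m) :
    (c k).im * (c (k + 1)).re - (c k).re * (c (k + 1)).im ≤ 0 ∧
    ((c k).im * (c (k + 1)).re - (c k).re * (c (k + 1)).im = 0 → ∀ j ≤ k, c j = 0) := by
  have vanish : ∀ {z : ℂ}, z.re ^ 2 + z.im ^ 2 = 0 → z = 0 := fun {z} hz =>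
    Complex.ext (by simp; nlinarith [sq_nonneg z.re, sq_nonneg z.im])
      (by simp; nlinarith [sq_nonneg z.re, sq_nonneg z.im])
  induction k with
  | zero =>
    have hr := congrArg Complex.re h0
    have hi := congrArg Complex.im h0
    simp at hr hi
    have key : ω * b 0 * ((c 0).im * (c 1).re - (c 0).re * (c 1).im) =
        d 0 * ((c 0).re ^ 2 + (c 0).im ^ 2) := by
      linear_combination -(c 0).re * hr - (c 0).im * hi
    have hp : 0 < ω * b 0 := mul_pos hω (hb 0)
    have hd0 := hd 0 hk
    constructor
    · have : d 0 * ((c 0).re ^ 2 + (c 0).im ^ 2) ≤ 0 :=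
        mul_nonpos_of_nonpos_of_nonneg hd0.le (by positivity)
      by_contra! hcon
      have := mul_pos hp hcon
      simp only [zero_add] at this
      linarith
    · intro hG j hj
      obtain rfl : j = 0 := by omega
      simp only [zero_add] at hG
      rw [hG, mul_zero] at key
      exact vanish ((mul_eq_zero.1 key.symm).resolve_left hd0.ne)
  | succ k ih =>
    obtain ⟨ih1, ih2⟩ := ih (by omega)
    have hr := congrArg Complex.re (hs k)
    have hi := congrArg Complex.im (hs k)
    simp at hr hi
    set G := (c k).im * (c (k + 1)).re - (c k).re * (c (k + 1)).im with hG
    have key : ω * b (k + 1) * ((c (k + 1)).im * (c (k + 2)).re - (c (k + 1)).re * (c (k + 2)).im) =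
        d (k + 1) * ((c (k + 1)).re ^ 2 + (c (k + 1)).im ^ 2) + ω * a k * G := by
      linear_combination -(c (k + 1)).re * hr - (c (k + 1)).im * hi - ω * a k * hG
    have hp : 0 < ω * b (k + 1) := mul_pos hω (hb _)
    have hq : 0 < ω * a k := mul_pos hω (ha k (by omega))
    have hdk := hd (k + 1) hk
    have t1 : d (k + 1) * ((c (k + 1)).re ^ 2 + (c (k + 1)).im ^ 2) ≤ 0 :=
      mul_nonpos_of_nonpos_of_nonneg hdk.le (by positivity)
    have t2 : ω * a k * G ≤ 0 := mul_nonpos_of_nonneg_of_nonpos hq.le ih1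
    constructor
    · by_contra! hcon
      have := mul_pos hp hcon
      linarith
    · intro hG' j hj
      rw [hG', mul_zero] at key
      rcases Nat.lt_or_eq_of_le hj with hj | rfl
      · have : ω * a k * G = 0 := by linarith
        exact ih2 ((mul_eq_zero.1 this).resolve_left hq.ne') j (by omega)
      · have : d (k + 1) * ((c (k + 1)).re ^ 2 + (c (k + 1)).im ^ 2) = 0 := by linarith
        exact vanish ((mul_eq_zero.1 this).resolve_left hdk.ne)

/-- The confluent Heun type equation has no polynomial solution of degree at most `m`. -/
lemma eq_zero_of_ode {m : ℕ} (hm : 0 < m) {ω : ℝ} (hω : 0 < ω) {P : ℂ[X]}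
    (hP : P ∈ degreeLT ℂ (m + 1))
    (hode : derivative ((X ^ 2 - 1) * derivative P) + (Complex.I * ω) • shift m P =
      (m * (m + 1) : ℂ) • P) : P = 0 := by
  set c : ℕ → ℂ := fun k => legendreBasis.coord k P
  have hcoord : ∀ k : ℕ, (k * (k + 1) : ℂ) * c k + Complex.I * ω *
      legendreBasis.coord k (shift m P) = m * (m + 1) * c k := fun k => by
    have := congrArg (legendreBasis.coord k) hode
    rwa [map_add, coord_legendre_operator, map_smul, map_smul] at this
  let d : ℕ → ℝ := fun k => k * (k + 1) - m * (m + 1)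
  let a : ℕ → ℝ := fun k => (k + 1) * (m - k) / (2 * k + 1)
  let b : ℕ → ℝ := fun k => (k + 1) * (k + 2 + m) / (2 * k + 3)
  have h0 : (d 0 : ℂ) * c 0 = Complex.I * ω * (b 0 * c 1) := by
    have h := hcoord 0
    rw [coord_zero_shift] at h
    simp only [d, b]
    push_cast at h ⊢
    linear_combination h
  have hs : ∀ k, (d (k + 1) : ℂ) * c (k + 1) =
      Complex.I * ω * (a k * c k + b (k + 1) * c (k + 2)) := fun k => by
    have h := hcoord (k + 1)
    rw [coord_succ_shift] at h
    simp only [d, a, b]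
    push_cast at h ⊢
    linear_combination h
  have hd : ∀ k < m, d k < 0 := fun k hk => by
    have : (k : ℝ) < m := by exact_mod_cast hk
    have h0 : (0 : ℝ) ≤ k := by positivity
    simp only [d]
    nlinarith
  have ha : ∀ k < m, 0 < a k := fun k hk => by
    have : (0 : ℝ) < m - k := sub_pos.2 (by exact_mod_cast hk)
    simp only [a]
    positivity
  have hb : ∀ k, 0 < b k := fun k => by
    simp only [b]
    positivity
  have hIω : Complex.I * (ω : ℂ) ≠ 0 :=
    mul_ne_zero Complex.I_ne_zero (by exact_mod_cast hω.ne')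
  have hlarge : ∀ k, m + 1 ≤ k → c k = 0 := fun k hk => legendreBasis_coord_eq_zero hk hP
  obtain ⟨n, rfl⟩ : ∃ n, m = n + 1 := ⟨m - 1, by omega⟩
  have hcn : c n = 0 := by
    have h := hs n
    rw [hlarge (n + 2) le_rfl, mul_zero, add_zero] at h
    have hdn : d (n + 1) = 0 := by simp only [d]; push_cast; ring
    rw [hdn, Complex.ofReal_zero, zero_mul, eq_comm] at h
    refine (mul_eq_zero.1 ((mul_eq_zero.1 h).resolve_left hIω)).resolve_left ?_
    exact_mod_cast (ha n (by omega)).ne'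
  have hsmall : ∀ j ≤ n, c j = 0 :=
    (tridiagonal_energy hω h0 hs hd ha hb (Nat.lt_succ_self n)).2 (by rw [hcn]; simp)
  have htop : c (n + 1) = 0 := by
    have hbn : ∀ k, (b k : ℂ) ≠ 0 := fun k => by exact_mod_cast (hb k).ne'
    cases n with
    | zero =>
      rw [hcn, mul_zero, eq_comm] at h0
      exact (mul_eq_zero.1 ((mul_eq_zero.1 h0).resolve_left hIω)).resolve_left (hbn 0)
    | succ n =>
      have h := hs n
      rw [hcn, hsmall n (by omega), mul_zero, mul_zero, zero_add, eq_comm] at h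
      exact (mul_eq_zero.1 ((mul_eq_zero.1 h).resolve_left hIω)).resolve_left (hbn _)
  refine legendreBasis.ext_elem fun k => ?_
  rw [map_zero]
  change c k = 0
  rcases lt_trichotomy k (n + 1) with h | rfl | h
  · exact hsmall k (by omega)
  · exact htop
  · exact hlarge k (by omega)

section DegreeLT

lemma mem_degreeLT_iff_coeff {n : ℕ} {f : ℂ[X]} :
    f ∈ degreeLT ℂ n ↔ ∀ k, n ≤ k → f.coeff k = 0 := by
  rw [mem_degreeLT, degree_lt_iff_coeff_zero]

lemma X_mul_mem_degreeLT {n : ℕ} {f : ℂ[X]} (hf : f ∈ degreeLT ℂ n) :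
    X * f ∈ degreeLT ℂ (n + 1) := by
  rw [mem_degreeLT_iff_coeff] at hf ⊢
  rintro (_ | k) hk
  · omega
  · rw [coeff_X_mul]
    exact hf k (by omega)

lemma C_mul_mem_degreeLT {n : ℕ} (a : ℂ) {f : ℂ[X]} (hf : f ∈ degreeLT ℂ n) :
    C a * f ∈ degreeLT ℂ n := by
  rw [← smul_eq_C_mul]
  exact Submodule.smul_mem _ a hf

lemma mem_degreeLT_of_le {m n : ℕ} (h : m ≤ n) {f : ℂ[X]} (hf : f ∈ degreeLT ℂ m) :
    f ∈ degreeLT ℂ n :=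
  degreeLT_mono h hf

lemma mem_degreeLT_of_coeff_eq_zero {n : ℕ} {f : ℂ[X]} (hf : f ∈ degreeLT ℂ (n + 1))
    (h : f.coeff n = 0) : f ∈ degreeLT ℂ n := by
  rw [mem_degreeLT_iff_coeff] at hf ⊢
  intro k hk
  rcases hk.eq_or_lt with rfl | hk
  · exact h
  · exact hf k hk

lemma one_sub_X_sq_mul_mem_degreeLT {n : ℕ} {f : ℂ[X]} (hf : f ∈ degreeLT ℂ n) :
    (1 - X ^ 2) * f ∈ degreeLT ℂ (n + 2) := by
  rw [show (1 - X ^ 2) * f = f - X * (X * f) by ring]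
  exact Submodule.sub_mem _ (mem_degreeLT_of_le (by omega) hf)
    (X_mul_mem_degreeLT (X_mul_mem_degreeLT hf))

lemma derivative_mem_degreeLT {n : ℕ} {f : ℂ[X]} (hf : f ∈ degreeLT ℂ (n + 1)) :
    derivative f ∈ degreeLT ℂ n := by
  rw [mem_degreeLT_iff_coeff] at hf ⊢
  intro k hk
  rw [coeff_derivative, hf (k + 1) (by omega), zero_mul]

lemma one_sub_X_sq_mul_derivative_mem_degreeLT {n : ℕ} {f : ℂ[X]} (hf : f ∈ degreeLT ℂ n) :
    (1 - X ^ 2) * derivative f ∈ degreeLT ℂ (n + 1) := by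
  cases n with
  | zero =>
    have : f = 0 := by
      ext k
      exact mem_degreeLT_iff_coeff.1 hf k (Nat.zero_le k)
    simp [this]
  | succ n => exact one_sub_X_sq_mul_mem_degreeLT (derivative_mem_degreeLT hf)

end DegreeLT

/-- The Sturm-Liouville operator `P ↦ w⁻¹ ((1 - X²) w P')'` for a weight with `w' = c w`. -/
noncomputable def sturm (c : ℂ) (P : ℂ[X]) : ℂ[X] :=
  derivative ((1 - X ^ 2) * derivative P) + C c * ((1 - X ^ 2) * derivative P)

lemma sturm_mem_degreeLT (c : ℂ) {n : ℕ} {f : ℂ[X]} (hf : f ∈ degreeLT ℂ n) :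
    sturm c f ∈ degreeLT ℂ (n + 1) := by
  have h := one_sub_X_sq_mul_derivative_mem_degreeLT hf
  exact Submodule.add_mem _
    (mem_degreeLT_of_le (Nat.le_succ n) (derivative_mem_degreeLT h)) (C_mul_mem_degreeLT c h)

section Functional

/-- The functional `L` satisfies the Pearson equation of a weight `w` on `[-1, 1]` with
`w' = c w`, tested against polynomials. -/
def Pearson (c : ℂ) (L : ℂ[X] →ₗ[ℂ] ℂ) : Prop :=
  ∀ f, L (derivative ((1 - X ^ 2) * f) + C c * ((1 - X ^ 2) * f)) = 0

/-- `P` is orthogonal to all polynomials of degree less than `n`. -/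
def Orth (L : ℂ[X] →ₗ[ℂ] ℂ) (P : ℂ[X]) (n : ℕ) : Prop :=
  ∀ f ∈ degreeLT ℂ n, L (P * f) = 0

/-- The bilinear form `(f, g) ↦ L (f g)` is degenerate on polynomials of degree less than `n`. -/
def Singular (L : ℂ[X] →ₗ[ℂ] ℂ) (n : ℕ) : Prop :=
  ∃ Q ∈ degreeLT ℂ n, Q ≠ 0 ∧ Orth L Q n

variable {L : ℂ[X] →ₗ[ℂ] ℂ} {c : ℂ} {P Q R : ℂ[X]} {m n : ℕ}

lemma Orth.mono (h : Orth L P n) (hmn : m ≤ n) : Orth L P m :=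
  fun f hf => h f (mem_degreeLT_of_le hmn hf)

lemma Orth.sub (hP : Orth L P n) (hQ : Orth L Q n) : Orth L (P - Q) n := fun f hf => by
  rw [sub_mul, map_sub, hP f hf, hQ f hf, sub_zero]

lemma Orth.C_mul (a : ℂ) (hP : Orth L P n) : Orth L (C a * P) n := fun f hf => by
  rw [mul_assoc, ← smul_eq_C_mul, map_smul, hP f hf, smul_zero]

lemma Orth.X_mul (hP : Orth L P (n + 1)) : Orth L (X * P) n := fun f hf => by
  rw [mul_comm X, mul_assoc]
  exact hP _ (X_mul_mem_degreeLT hf)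

lemma Orth.linear_mul (a b : ℂ) (hP : Orth L P (n + 1)) : Orth L ((C a * X + C b) * P) n := by
  rw [show (C a * X + C b) * P = C a * (X * P) - C (-b) * P by rw [C_neg]; ring]
  exact (hP.X_mul.C_mul a).sub ((hP.mono (Nat.le_succ n)).C_mul (-b))

lemma Orth.succ (hP : Orth L P n) (h : L (P * X ^ n) = 0) : Orth L P (n + 1) := fun f hf => by
  have hg : f - C (f.coeff n) * X ^ n ∈ degreeLT ℂ n := by
    refine mem_degreeLT_of_coeff_eq_zero (Submodule.sub_mem _ hf ?_) (by simp)
    refine C_mul_mem_degreeLT _ (mem_degreeLT.2 ?_)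
    rw [degree_X_pow]
    exact_mod_cast Nat.lt_succ_self n
  have := hP _ hg
  rw [mul_sub, map_sub, mul_left_comm, ← smul_eq_C_mul, map_smul, h, smul_zero, sub_zero] at this
  exact this

lemma orth_of_pow (h : ∀ j < n, L (P * X ^ j) = 0) : Orth L P n := by
  induction n with
  | zero =>
    intro f hf
    have : f = 0 := by
      ext k
      exact mem_degreeLT_iff_coeff.1 hf k (Nat.zero_le k)
    simp [this]
  | succ n ih => exact (ih fun j hj => h j (by omega)).succ (h n (Nat.lt_succ_self n))

lemma not_singular_zero : ¬ Singular L 0 := by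
  rintro ⟨Q, hQ, hQ0, -⟩
  apply hQ0
  ext k
  exact mem_degreeLT_iff_coeff.1 hQ k (Nat.zero_le k)

lemma eq_zero_of_not_singular (h : ¬ Singular L n) (hQ : Q ∈ degreeLT ℂ n) (hO : Orth L Q n) :
    Q = 0 := by
  by_contra h0
  exact h ⟨Q, hQ, h0, hO⟩

/-- A maximally orthogonal monic polynomial of degree `m`. -/
lemma exists_monic_orth (h : ¬ Singular L m) (h' : Singular L (m + 1)) :
    ∃ P ∈ degreeLT ℂ (m + 1), P.coeff m = 1 ∧ Orth L P (m + 1) := by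
  obtain ⟨Q, hQ, hQ0, hO⟩ := h'
  have hc : Q.coeff m ≠ 0 := fun hc =>
    hQ0 (eq_zero_of_not_singular h (mem_degreeLT_of_coeff_eq_zero hQ hc) (hO.mono (Nat.le_succ m)))
  exact ⟨C (Q.coeff m)⁻¹ * Q, C_mul_mem_degreeLT _ hQ, by simp [hc], hO.C_mul _⟩

lemma eq_linear_mul (h : ¬ Singular L m) (hP : P ∈ degreeLT ℂ (m + 1)) (hP1 : P.coeff m = 1)
    (hPO : Orth L P (m + 1)) (hR : R ∈ degreeLT ℂ (m + 2)) (hRO : Orth L R m) :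
    ∃ a b, R = (C a * X + C b) * P := by
  have h1 : R - C (R.coeff (m + 1)) * (X * P) ∈ degreeLT ℂ (m + 1) :=
    mem_degreeLT_of_coeff_eq_zero
      (Submodule.sub_mem _ hR (C_mul_mem_degreeLT _ (X_mul_mem_degreeLT hP))) (by simp [hP1])
  set R₁ := R - C (R.coeff (m + 1)) * (X * P) with hR₁
  have h2 : R₁ - C (R₁.coeff m) * P ∈ degreeLT ℂ m :=
    mem_degreeLT_of_coeff_eq_zero
      (Submodule.sub_mem _ h1 (C_mul_mem_degreeLT _ hP)) (by simp [hP1])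
  have h3 := eq_zero_of_not_singular h h2
    ((hRO.sub (hPO.X_mul.C_mul _)).sub ((hPO.mono (Nat.le_succ m)).C_mul _))
  refine ⟨R.coeff (m + 1), R₁.coeff m, ?_⟩
  linear_combination h3 + hR₁

lemma Pearson.apply_sturm_mul (hL : Pearson c L) (P f : ℂ[X]) :
    L (sturm c P * f) = L (P * sturm c f) := by
  have h1 := hL (derivative P * f)
  have h2 := hL (P * derivative f)
  rw [← sub_eq_zero, ← map_sub]
  have e : sturm c P * f - P * sturm c f =
      (derivative ((1 - X ^ 2) * (derivative P * f)) + C c * ((1 - X ^ 2) * (derivative P * f))) -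
      (derivative ((1 - X ^ 2) * (P * derivative f)) +
        C c * ((1 - X ^ 2) * (P * derivative f))) := by
    simp only [sturm, derivative_mul]
    ring
  rw [e, map_sub, h1, h2, sub_zero]

lemma Pearson.orth_sturm (hL : Pearson c L) (hP : Orth L P (n + 1)) : Orth L (sturm c P) n :=
  fun f hf => by
    rw [hL.apply_sturm_mul]
    exact hP _ (sturm_mem_degreeLT c hf)

lemma Pearson.orth_one_sub_X_sq_mul_derivative (hL : Pearson c L) (hP : Orth L P (n + 2)) :
    Orth L ((1 - X ^ 2) * derivative P) n := fun f hf => by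
  have h1 := hL (P * f)
  have hg : derivative ((1 - X ^ 2) * f) + C c * ((1 - X ^ 2) * f) ∈ degreeLT ℂ (n + 2) := by
    have := one_sub_X_sq_mul_mem_degreeLT hf
    exact Submodule.add_mem _
      (mem_degreeLT_of_le (Nat.le_succ _) (derivative_mem_degreeLT this)) (C_mul_mem_degreeLT c this)
  have e : derivative ((1 - X ^ 2) * (P * f)) + C c * ((1 - X ^ 2) * (P * f)) =
      (1 - X ^ 2) * derivative P * f +
        P * (derivative ((1 - X ^ 2) * f) + C c * ((1 - X ^ 2) * f)) := by
    simp only [derivative_mul]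
    ring
  rw [e, map_add, hP _ hg, add_zero] at h1
  exact h1

/-- The polynomial `P` satisfies a second order linear differential equation. -/
lemma exists_sturm_eq (hL : Pearson c L) (h : ¬ Singular L m) (hP : P ∈ degreeLT ℂ (m + 1))
    (hP1 : P.coeff m = 1) (hPO : Orth L P (m + 1)) :
    ∃ a b, sturm c P = (C a * X + C b) * P :=
  eq_linear_mul h hP hP1 hPO (sturm_mem_degreeLT c hP) (hL.orth_sturm hPO)

lemma coeff_one_sub_X_sq_mul_derivative (P : ℂ[X]) (n : ℕ) :
    ((1 - X ^ 2) * derivative P).coeff (n + 1) =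
      (n + 2) * P.coeff (n + 2) - n * P.coeff n := by
  rw [show (1 - X ^ 2) * derivative P = derivative P - X * (X * derivative P) by ring,
    coeff_sub, coeff_X_mul, coeff_derivative]
  cases n with
  | zero => simp; ring
  | succ n =>
    rw [coeff_X_mul, coeff_derivative]
    push_cast
    ring

lemma coeff_linear_mul (a b : ℂ) (P : ℂ[X]) (n : ℕ) :
    ((C a * X + C b) * P).coeff (n + 1) = a * P.coeff n + b * P.coeff (n + 1) := by
  rw [add_mul, mul_assoc, coeff_add, coeff_C_mul, coeff_X_mul, coeff_C_mul]

lemma coeff_sturm (c : ℂ) (P : ℂ[X]) (n : ℕ) :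
    (sturm c P).coeff (n + 1) =
      (n + 2) * ((n + 3) * P.coeff (n + 3) - (n + 1) * P.coeff (n + 1)) +
        c * ((n + 2) * P.coeff (n + 2) - n * P.coeff n) := by
  rw [sturm, coeff_add, coeff_C_mul, coeff_one_sub_X_sq_mul_derivative, coeff_derivative,
    coeff_one_sub_X_sq_mul_derivative]
  push_cast
  ring

/-- A monic polynomial of positive degree `m` is not orthogonal to all polynomials of degree at
most `m + 1`. -/
lemma not_orth_add_two (hL : Pearson c L) (hm : m ≠ 0) (h : ¬ Singular L m)
    (hP : P ∈ degreeLT ℂ (m + 1)) (hP1 : P.coeff m = 1) : ¬ Orth L P (m + 2) := by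
  intro hPO
  obtain ⟨α, β, hE⟩ := exists_sturm_eq hL h hP hP1 (hPO.mono (Nat.le_succ _))
  obtain ⟨a, b, hT⟩ := eq_linear_mul h hP hP1 (hPO.mono (Nat.le_succ _))
    (one_sub_X_sq_mul_derivative_mem_degreeLT hP) (hL.orth_one_sub_X_sq_mul_derivative hPO)
  have hP0 : P ≠ 0 := fun h0 => by simp [h0] at hP1
  have hbig := mem_degreeLT_iff_coeff.1 hP
  have ha : a = -m := by
    have := congrArg (coeff · (m + 1)) hT
    simp only [coeff_one_sub_X_sq_mul_derivative, coeff_linear_mul, hP1, hbig (m + 1) le_rfl,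
      hbig (m + 2) (Nat.le_succ _)] at this
    linear_combination -this
  have hsq : (C a * X + C b) ^ 2 = (C (α - c * a) * X + C (β - c * b - a)) * (1 - X ^ 2) := by
    apply mul_right_cancel₀ hP0
    rw [sturm, hT] at hE
    simp only [derivative_mul, derivative_add, derivative_C, derivative_X] at hE
    simp only [C_sub, C_mul]
    linear_combination (1 - X ^ 2) * hE - (C a * X + C b) * hT
  have h1 := congrArg (eval 1) hsq
  have h2 := congrArg (eval (-1)) hsq
  simp at h1 h2
  have : a = 0 := by linear_combination (h1 - h2) / 2
  exact hm (by exact_mod_cast neg_eq_zero.1 (ha.symm.trans this))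

lemma orth_add_two_of_singular (h : ¬ Singular L m) (h2 : Singular L (m + 2))
    (hP : P ∈ degreeLT ℂ (m + 1)) (hP1 : P.coeff m = 1) (hPO : Orth L P (m + 1)) :
    Orth L P (m + 2) := by
  obtain ⟨Q, hQ, hQ0, hQO⟩ := h2
  obtain ⟨a, b, rfl⟩ := eq_linear_mul h hP hP1 hPO hQ (hQO.mono (by omega))
  have hXm : ∀ j ≤ m + 1, (X : ℂ[X]) ^ j ∈ degreeLT ℂ (m + 2) := fun j hj => by
    rw [mem_degreeLT, degree_X_pow]
    exact_mod_cast (by omega : j < m + 2)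
  refine hPO.succ ?_
  by_cases ha : a = 0
  · subst ha
    have hb : b ≠ 0 := by
      rintro rfl
      simp at hQ0
    have := hQO _ (hXm (m + 1) le_rfl)
    rw [C_0, zero_mul, zero_add, mul_assoc, ← smul_eq_C_mul, map_smul, smul_eq_mul] at this
    exact (mul_eq_zero.1 this).resolve_left hb
  · have hlow : L (P * X ^ m) = 0 := hPO _ (by
      rw [mem_degreeLT, degree_X_pow]
      exact_mod_cast Nat.lt_succ_self m)
    have := hQO _ (hXm m (Nat.le_succ m))
    rw [show (C a * X + C b) * P * X ^ m = a • (P * X ^ (m + 1)) + b • (P * X ^ m) by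
      simp only [smul_eq_C_mul]; ring, map_add, map_smul, map_smul, hlow, smul_zero, add_zero,
      smul_eq_mul] at this
    exact (mul_eq_zero.1 this).resolve_left ha

lemma coeff_relation_of_singular (hL : Pearson c L) (hs : Singular L (m + 1))
    (h : ¬ Singular L (m + 2)) (hP : P ∈ degreeLT ℂ (m + 3)) (hP1 : P.coeff (m + 2) = 1)
    (hPO : Orth L P (m + 3)) :
    (m + 2 : ℂ) + 2 * P.coeff m = P.coeff (m + 1) ^ 2 := by
  have hbig := mem_degreeLT_iff_coeff.1 hP
  set p₁ := P.coeff (m + 1)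
  set T := (1 - X ^ 2) * derivative P - (C (-(m + 2 : ℂ)) * X + C p₁) * P with hT
  have hTO : Orth L T (m + 1) :=
    (hL.orth_one_sub_X_sq_mul_derivative hPO).sub
      ((hPO.linear_mul _ _).mono (Nat.le_succ _))
  have hTd : T ∈ degreeLT ℂ (m + 4) := by
    refine Submodule.sub_mem _ (one_sub_X_sq_mul_derivative_mem_degreeLT hP) ?_
    rw [add_mul, mul_assoc]
    exact Submodule.add_mem _ (C_mul_mem_degreeLT _ (X_mul_mem_degreeLT hP))
      (C_mul_mem_degreeLT _ (mem_degreeLT_of_le (Nat.le_succ _) hP))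
  have hc3 : T.coeff (m + 3) = 0 := by
    rw [hT, coeff_sub, coeff_one_sub_X_sq_mul_derivative, coeff_linear_mul, hP1,
      hbig (m + 3) le_rfl, hbig (m + 4) (Nat.le_succ _)]
    push_cast
    ring
  have hc2 : T.coeff (m + 2) = 0 := by
    rw [hT, coeff_sub, coeff_one_sub_X_sq_mul_derivative, coeff_linear_mul, hP1,
      hbig (m + 3) le_rfl]
    push_cast
    ring
  have hTd' : T ∈ degreeLT ℂ (m + 2) :=
    mem_degreeLT_of_coeff_eq_zero (mem_degreeLT_of_coeff_eq_zero hTd hc3) hc2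
  obtain ⟨Q, hQ, hQ0, hQO⟩ := hs
  have hσ : L (Q * X ^ (m + 1)) ≠ 0 := fun hσ =>
    hQ0 (eq_zero_of_not_singular h (mem_degreeLT_of_le (Nat.le_succ _) hQ) (hQO.succ hσ))
  set r := L (T * X ^ (m + 1)) / L (Q * X ^ (m + 1))
  have hTQ : T - C r * Q = 0 := by
    refine eq_zero_of_not_singular h
      (Submodule.sub_mem _ hTd' (C_mul_mem_degreeLT _ (mem_degreeLT_of_le (Nat.le_succ _) hQ)))
      ((hTO.sub (hQO.C_mul r)).succ ?_)
    rw [sub_mul, map_sub, mul_assoc, ← smul_eq_C_mul, map_smul, smul_eq_mul,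
      div_mul_cancel₀ _ hσ, sub_self]
  have hc1 : T.coeff (m + 1) = 0 := by
    rw [sub_eq_zero.1 hTQ, coeff_C_mul, mem_degreeLT_iff_coeff.1 hQ (m + 1) le_rfl, mul_zero]
  rw [hT, coeff_sub, coeff_one_sub_X_sq_mul_derivative, coeff_linear_mul, hP1] at hc1
  linear_combination hc1

/-- Two singular indices cannot be separated by a single regular one. -/
lemma not_singular_add_two_of_not_singular {ω : ℝ} (hω : 0 < ω) (hL : Pearson (Complex.I * ω) L)
    (hs : Singular L (m + 1)) (h : ¬ Singular L (m + 2)) : ¬ Singular L (m + 3) := by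
  intro hs'
  obtain ⟨P, hP, hP1, hPO⟩ := exists_monic_orth h hs'
  obtain ⟨a, b, hE⟩ := exists_sturm_eq hL h hP hP1 hPO
  have hrel := coeff_relation_of_singular hL hs h hP hP1 hPO
  have hbig := mem_degreeLT_iff_coeff.1 hP
  set c : ℂ := Complex.I * ω
  have e1 := congrArg (coeff · (m + 3)) hE
  have e2 := congrArg (coeff · (m + 2)) hE
  have e3 := congrArg (coeff · (m + 1)) hE
  simp only [coeff_sturm, coeff_linear_mul, hP1, hbig (m + 3) le_rfl,
    hbig (m + 4) (by omega), hbig (m + 5) (by omega)] at e1 e2 e3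
  push_cast at e1 e2 e3
  have ha : a = -c * (m + 2) := by linear_combination -e1
  subst ha
  have hb : b = -((m + 2) * (m + 3)) + c * P.coeff (m + 1) := by linear_combination -e2
  subst hb
  have hp₁ : P.coeff (m + 1) = 0 := by
    have hm : (2 * (m + 2) : ℂ) ≠ 0 := by exact_mod_cast (by omega : 2 * (m + 2) ≠ 0)
    apply (mul_eq_zero.1 _).resolve_left hm
    linear_combination e3 - c * hrel
  have hode : derivative ((X ^ 2 - 1) * derivative P) + c • shift (m + 2) P =
      (((m + 2 : ℕ) : ℂ) * ((m + 2 : ℕ) + 1)) • P := by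
    rw [hp₁, mul_zero, add_zero, sturm,
      show (1 - X ^ 2) * derivative P = -((X ^ 2 - 1) * derivative P) by ring, derivative_neg] at hE
    rw [shift_apply, smul_eq_C_mul, smul_eq_C_mul]
    simp [C_two, C_three] at hE ⊢
    linear_combination -hE
  have := eq_zero_of_ode (by omega) hω hP hode
  simp [this] at hP1

/-- Two consecutive indices cannot both be singular. -/
lemma not_singular_succ_of_singular (hL : Pearson c L) (h2 : ¬ Singular L 1 ∨ ¬ Singular L 2)
    (hs : Singular L n) : ¬ Singular L (n + 1) := by
  induction n with
  | zero => exact absurd hs not_singular_zero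
  | succ n ih =>
    intro hs'
    by_cases h : Singular L n
    · exact ih h hs
    · rcases eq_or_ne n 0 with rfl | hn
      · exact h2.elim (· hs) (· hs')
      · obtain ⟨P, hP, hP1, hPO⟩ := exists_monic_orth h hs
        exact not_orth_add_two hL hn h hP hP1 (orth_add_two_of_singular h hs' hP hP1 hPO)

end Functional

section Oscillatory

/-- Integration against the oscillatory weight `e^{iωx}` on `[-1,1]`. -/
noncomputable def oscIntegral (ω : ℝ) : ℂ[X] →ₗ[ℂ] ℂ where
  toFun f := ∫ x : ℝ in (-1 : ℝ)..1, f.eval (x : ℂ) * Complex.exp (Complex.I * ω * x)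
  map_add' f g := by
    rw [← intervalIntegral.integral_add]
    · simp [add_mul]
    all_goals exact Continuous.intervalIntegrable (by fun_prop) _ _
  map_smul' a f := by
    simp [mul_assoc, intervalIntegral.integral_const_mul]

lemma oscIntegral_X_pow (ω : ℝ) (n : ℕ) : oscIntegral ω (X ^ n) = mu ω n := by
  simp [oscIntegral, mu]

lemma oscIntegral_derivative (ω : ℝ) (f : ℂ[X]) :
    oscIntegral ω (derivative f + C (Complex.I * ω) * f) =
      f.eval 1 * Complex.exp (Complex.I * ω) - f.eval (-1) * Complex.exp (-(Complex.I * ω)) := by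
  have hd : ∀ x : ℝ, HasDerivAt
      (fun x : ℝ => f.eval (x : ℂ) * Complex.exp (Complex.I * ω * x))
      ((derivative f + C (Complex.I * ω) * f).eval (x : ℂ) * Complex.exp (Complex.I * ω * x)) x := by
    intro x
    have h1 : HasDerivAt (fun z : ℂ => f.eval z * Complex.exp (Complex.I * ω * z))
        ((derivative f + C (Complex.I * ω) * f).eval (x : ℂ) *
          Complex.exp (Complex.I * ω * x)) (x : ℂ) := by
      have h2 : HasDerivAt (fun z : ℂ => Complex.exp (Complex.I * ω * z))
          (Complex.exp (Complex.I * ω * x) * (Complex.I * ω)) (x : ℂ) := by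
        simpa using ((hasDerivAt_id (x : ℂ)).const_mul (Complex.I * (ω : ℂ))).cexp
      refine ((f.hasDerivAt (x : ℂ)).mul h2).congr_deriv ?_
      rw [eval_add, eval_mul, eval_C]
      ring
    exact h1.comp_ofReal
  have := intervalIntegral.integral_eq_sub_of_hasDerivAt (a := -1) (b := 1) (fun x _ => hd x)
    (Continuous.intervalIntegrable (by fun_prop) _ _)
  simpa [oscIntegral] using this

lemma pearson_oscIntegral (ω : ℝ) : Pearson (Complex.I * ω) (oscIntegral ω) := fun f => by
  rw [oscIntegral_derivative]
  simp

lemma not_singular_one_or_two (ω : ℝ) :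
    ¬ Singular (oscIntegral ω) 1 ∨ ¬ Singular (oscIntegral ω) 2 := by
  by_contra! hcon
  obtain ⟨h1, h2⟩ := hcon
  obtain ⟨P, hP, hP1, hPO⟩ := exists_monic_orth not_singular_zero h1
  have hO := orth_add_two_of_singular not_singular_zero h2 hP hP1 hPO
  obtain rfl : P = 1 := by
    ext k
    cases k with
    | zero => simpa using hP1
    | succ k =>
      rw [mem_degreeLT_iff_coeff.1 hP (k + 1) (by omega), coeff_one]
      simp
  have m0 : oscIntegral ω 1 = 0 := by
    simpa using hO 1 (by rw [mem_degreeLT]; simp)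
  have m1 : oscIntegral ω X = 0 := by
    simpa using hO X (by rw [mem_degreeLT]; simp)
  have e0 := oscIntegral_derivative ω 1
  have e1 := oscIntegral_derivative ω X
  rw [map_add, ← smul_eq_C_mul, map_smul, m0] at e0
  rw [map_add, ← smul_eq_C_mul, map_smul, m1, derivative_X, m0] at e1
  simp at e0 e1
  apply Complex.exp_ne_zero (Complex.I * ω)
  linear_combination -(e0 + e1) / 2

lemma singular_of_hankel_eq_zero {n : ℕ} {ω : ℝ} (h : hankel n ω = 0) :
    Singular (oscIntegral ω) (n + 1) := by
  obtain ⟨v, hv0, hv⟩ := Matrix.exists_mulVec_eq_zero_iff.2 h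
  refine ⟨((degreeLTEquiv ℂ (n + 1)).symm v : ℂ[X]), Subtype.property _, ?_, ?_⟩
  · simpa using hv0
  · refine orth_of_pow fun j hj => ?_
    have hj' := congrFun hv ⟨j, hj⟩
    have hsum : (((degreeLTEquiv ℂ (n + 1)).symm v : degreeLT ℂ (n + 1)) : ℂ[X]) * X ^ j =
        ∑ i : Fin (n + 1), v i • (X : ℂ[X]) ^ (j + (i : ℕ)) := by
      simp only [degreeLTEquiv, LinearEquiv.coe_symm_mk', Finset.sum_mul, ← smul_X_eq_monomial,
        smul_mul_assoc, ← pow_add, add_comm j]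
    rw [hsum, map_sum]
    simp only [map_smul, oscIntegral_X_pow]
    simpa [Matrix.mulVec, dotProduct, mul_comm] using hj'

end Oscillatory

end KissingPolynomial

/-- Hankel determinants two indices apart have no common positive real zero. -/
theorem stmt18 :
    ¬ ∃ (n : ℕ) (ω : ℝ), 0 < ω ∧ hankel n ω = 0 ∧ hankel (n + 2) ω = 0 := by
  rintro ⟨n, ω, hω, h0, h2⟩
  have hL := KissingPolynomial.pearson_oscIntegral ω
  have hs := KissingPolynomial.singular_of_hankel_eq_zero h0
  exact KissingPolynomial.not_singular_add_two_of_not_singular hω hL hs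
    (KissingPolynomial.not_singular_succ_of_singular hL
      (KissingPolynomial.not_singular_one_or_two ω) hs)
    (KissingPolynomial.singular_of_hankel_eq_zero h2)
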